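/- Let n ≥ 2 and let f be a polynomially tamed function on Σ_n of the form f(x,y) = ∑_{(i,j)} a_{i,j}·(x^1)^i·(y^1)^j, a finite sum over pairs of integers with i ≥ 0 and j ≤ 0, in which each coefficient a_{i,j} is a function on Σ_n that does not depend on (x^1, y^1) and belongs to the analogous ring O'(x,y) in the variables (x^2,y^2,…,x^n,y^n). Assume that |f| ≺ 1 holds on every linear test set, i.e., on every set Σ_n ∩ {α^1 φ^1 + β^1 = ⋯ = α^{n₀} φ^{n₀} + β^{n₀}, φ^{n₀+1} = ζ^{n₀+1}, …, φ^n = ζ^n} with 1 ≤ n₀ ≤ n, positive rationals α^k, reals β^k, and ζ^k in the upper half-plane, where φ^k = x^k + i y^k. Then for every pair (i,j) occurring in the sum, |a_{i,j}|·(y^1)^j ≺ 1 on Σ_n. -/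

import Mathlib

namespace TamePaper

noncomputable section

/-- The point space: `n` pairs of real coordinates `(x, y)`. -/
abbrev Pt (n : ℕ) := (Fin n → ℝ) × (Fin n → ℝ)

/-- The growth sector `Σ_n = {0 < xᵏ < 1, y¹ ≥ y² ≥ ⋯ ≥ yⁿ > 1}`. -/
def GrowthSector (n : ℕ) : Set (Pt n) :=
  {p | (∀ k, 0 < p.1 k ∧ p.1 k < 1) ∧
       (∀ k l : Fin n, k ≤ l → p.2 l ≤ p.2 k) ∧ (∀ k, 1 < p.2 k)}

/-- `f ≺ g` on `S`: there is `C > 0` with `f < C·g` everywhere on `S`. -/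
def Prec {α : Type*} (S : Set α) (f g : α → ℝ) : Prop :=
  ∃ C : ℝ, 0 < C ∧ ∀ p ∈ S, f p < C * g p

/-- `f ∼ g` on `S`: `C₁·g < f < C₂·g` on `S` for two constants of the same sign. -/
def Sim {α : Type*} (S : Set α) (f g : α → ℝ) : Prop :=
  ∃ C₁ C₂ : ℝ, 0 < C₁ * C₂ ∧ ∀ p ∈ S, C₁ * g p < f p ∧ f p < C₂ * g p

/-- The closed unit polydisk in `ℝ^{2n}`. -/
def ClosedPolydisk (n : ℕ) : Set (Fin n → ℝ × ℝ) :=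
  {q | ∀ k, (q k).1 ^ 2 + (q k).2 ^ 2 ≤ 1}

/-- A restricted analytic function: real-analytic on an open neighborhood of the
closed unit polydisk. -/
def RestrictedAnalytic (n : ℕ) (ρ : (Fin n → ℝ × ℝ) → ℝ) : Prop :=
  ∃ U : Set (Fin n → ℝ × ℝ), IsOpen U ∧ ClosedPolydisk n ⊆ U ∧ AnalyticOnNhd ℝ ρ U

/-- The coordinates `uᵏ = e^{-2πyᵏ} cos(2πxᵏ)`, `vᵏ = e^{-2πyᵏ} sin(2πxᵏ)`. -/
def uv (n : ℕ) (p : Pt n) : Fin n → ℝ × ℝ := fun k =>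
  (Real.exp (-(2 * Real.pi * p.2 k)) * Real.cos (2 * Real.pi * p.1 k),
   Real.exp (-(2 * Real.pi * p.2 k)) * Real.sin (2 * Real.pi * p.1 k))

/-- Membership in the ring `O`: on `Σ_n`, `f` is given by a restricted analytic
function of the variables `uᵏ, vᵏ`. -/
def InO (n : ℕ) (f : Pt n → ℝ) : Prop :=
  ∃ ρ, RestrictedAnalytic n ρ ∧ ∀ p ∈ GrowthSector n, f p = ρ (uv n p)

/-- The monomial `(y¹)^{m₁} ⋯ (yⁿ)^{mₙ}`. -/
def monomial (n : ℕ) (m : Fin n → ℤ) : Pt n → ℝ := fun p => ∏ k, p.2 k ^ m k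

/-- Membership in `O[x,y,y⁻¹]`: a finite sum `∑ ρ_{k,m} x^k y^m` with `ρ_{k,m} ∈ O`,
`k ∈ ℕⁿ`, `m ∈ ℤⁿ`. -/
def InOPoly (n : ℕ) (f : Pt n → ℝ) : Prop :=
  ∃ (T : Finset ((Fin n → ℕ) × (Fin n → ℤ)))
    (ρ : ((Fin n → ℕ) × (Fin n → ℤ)) → Pt n → ℝ),
    (∀ km ∈ T, InO n (ρ km)) ∧
    ∀ p ∈ GrowthSector n,
      f p = ∑ km ∈ T, ρ km p * (∏ k, p.1 k ^ km.1 k) * (∏ k, p.2 k ^ km.2 k)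

/-- Membership in `O(x,y)`: a quotient `g/h` with `g, h ∈ O[x,y,y⁻¹]` and `h`
nowhere vanishing on `Σ_n`. -/
def InOFrac (n : ℕ) (f : Pt n → ℝ) : Prop :=
  ∃ g h, InOPoly n g ∧ InOPoly n h ∧ (∀ p ∈ GrowthSector n, h p ≠ 0) ∧
    ∀ p ∈ GrowthSector n, f p = g p / h p

/-- `f` has monomial growth: `f ∼ (y¹)^{m₁}⋯(yⁿ)^{mₙ}` on `Σ_n` for some `m ∈ ℤⁿ`. -/
def MonGrowth (n : ℕ) (f : Pt n → ℝ) : Prop :=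
  ∃ m : Fin n → ℤ, Sim (GrowthSector n) f (monomial n m)

/-- `f` is monomially tamed: `f ∈ O(x,y)` and `f ∼ (y¹)^{m₁}⋯(yⁿ)^{mₙ}` on `Σ_n`. -/
def MonTamed (n : ℕ) (f : Pt n → ℝ) : Prop := InOFrac n f ∧ MonGrowth n f

/-- `f` is polynomially tamed: `f = g/h` with `g ∈ O[x,y,y⁻¹]` and `h` monomially tamed. -/
def PolyTamed (n : ℕ) (f : Pt n → ℝ) : Prop :=
  ∃ g h, InOPoly n g ∧ MonTamed n h ∧ (∀ p ∈ GrowthSector n, h p ≠ 0) ∧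
    ∀ p ∈ GrowthSector n, f p = g p / h p

/-- The linear test set `{α¹φ¹+β¹ = ⋯ = α^{n₀}φ^{n₀}+β^{n₀}, φ^{n₀+1} = ζ^{n₀+1}, …, φⁿ = ζⁿ}`,
where `φᵏ = xᵏ + i yᵏ`. -/
def LinearTestSet (n n₀ : ℕ) (α : Fin n → ℚ) (β : Fin n → ℝ) (ζ : Fin n → ℂ) :
    Set (Pt n) :=
  {p | (∀ k l : Fin n, (k : ℕ) < n₀ → (l : ℕ) < n₀ →
          (α k : ℂ) * ((p.1 k : ℂ) + (p.2 k : ℂ) * Complex.I) + (β k : ℂ)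
            = (α l : ℂ) * ((p.1 l : ℂ) + (p.2 l : ℂ) * Complex.I) + (β l : ℂ)) ∧
       ∀ k : Fin n, n₀ ≤ (k : ℕ) → (p.1 k : ℂ) + (p.2 k : ℂ) * Complex.I = ζ k}

/-- Lipschitz on the closed polydisk. -/
def Lip (n : ℕ) (ρ : (Fin n → ℝ × ℝ) → ℝ) : Prop :=
  ∃ L : ℝ, 0 ≤ L ∧ ∀ w ∈ ClosedPolydisk n, ∀ w' ∈ ClosedPolydisk n, |ρ w - ρ w'| ≤ L * ‖w - w'‖

lemma closedPolydisk_convex (n : ℕ) : Convex ℝ (ClosedPolydisk n) := by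
  intro p hp q hq a b ha hb hab k
  have h1 := hp k
  have h2 := hq k
  simp only [Pi.add_apply, Pi.smul_apply, Prod.fst_add, Prod.snd_add, Prod.smul_fst,
    Prod.smul_snd, smul_eq_mul]
  obtain rfl : b = 1 - a := by linarith
  have e : (a * (p k).1 + (1 - a) * (q k).1) ^ 2 + (a * (p k).2 + (1 - a) * (q k).2) ^ 2
    = a * ((p k).1 ^ 2 + (p k).2 ^ 2) + (1 - a) * ((q k).1 ^ 2 + (q k).2 ^ 2)
      - a * (1 - a) * (((p k).1 - (q k).1) ^ 2 + ((p k).2 - (q k).2) ^ 2) := by ring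
  rw [e]
  have h3 : 0 ≤ a * (1 - a) * (((p k).1 - (q k).1) ^ 2 + ((p k).2 - (q k).2) ^ 2) := by
    positivity
  nlinarith [mul_le_mul_of_nonneg_left h1 ha, mul_le_mul_of_nonneg_left h2 hb]

lemma closedPolydisk_compact (n : ℕ) : IsCompact (ClosedPolydisk n) := by
  apply Metric.isCompact_of_isClosed_isBounded
  · have : ClosedPolydisk n = ⋂ k, {q | (q k).1 ^ 2 + (q k).2 ^ 2 ≤ 1} := by
      ext q; simp [ClosedPolydisk]
    rw [this]
    refine isClosed_iInter fun k => isClosed_le ?_ continuous_const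
    fun_prop
  · rw [isBounded_iff_forall_norm_le]
    refine ⟨1, fun q hq => ?_⟩
    rw [pi_norm_le_iff_of_nonneg zero_le_one]
    intro k
    have := hq k
    rw [Prod.norm_def]
    refine max_le ?_ ?_ <;> rw [Real.norm_eq_abs, ← sq_le_one_iff_abs_le_one] <;> nlinarith [sq_nonneg (q k).1, sq_nonneg (q k).2]

lemma RestrictedAnalytic.lip {n : ℕ} {ρ} (h : RestrictedAnalytic n ρ) : Lip n ρ := by
  obtain ⟨U, _, hU, hρ⟩ := h
  have h1 : ContDiffOn ℝ 1 ρ (ClosedPolydisk n) :=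
    fun w hw => ((hρ w (hU hw)).contDiffAt).contDiffWithinAt
  obtain ⟨K, hK⟩ := h1.exists_lipschitzOnWith one_ne_zero (closedPolydisk_convex n)
    (closedPolydisk_compact n)
  refine ⟨K, K.2, fun w hw w' hw' => ?_⟩
  have := hK.dist_le_mul w hw w' hw'
  rwa [Real.dist_eq, dist_eq_norm] at this

lemma uv_mem {n : ℕ} {p : Pt n} (hp : ∀ k, 0 < p.2 k) : uv n p ∈ ClosedPolydisk n := by
  intro k
  simp only [uv]
  have e : (Real.exp (-(2 * Real.pi * p.2 k)) * Real.cos (2 * Real.pi * p.1 k)) ^ 2 +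
   (Real.exp (-(2 * Real.pi * p.2 k)) * Real.sin (2 * Real.pi * p.1 k)) ^ 2
     = Real.exp (-(2 * Real.pi * p.2 k)) ^ 2 := by
    rw [mul_pow, mul_pow, ← mul_add, Real.cos_sq_add_sin_sq, mul_one]
  rw [e]
  apply pow_le_one₀ (Real.exp_pos _).le
  rw [Real.exp_le_one_iff]
  have := hp k
  have := Real.pi_pos
  rw [neg_nonpos]; positivity

lemma cons_mem {n : ℕ} {w : Fin n → ℝ × ℝ} (hw : w ∈ ClosedPolydisk n) :
    (Fin.cons 0 w : Fin (n + 1) → ℝ × ℝ) ∈ ClosedPolydisk (n + 1) := by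
  intro k
  refine Fin.cases ?_ (fun k => ?_) k
  · simp
  · simpa using hw k

lemma Lip.cons {n : ℕ} {ρ} (h : Lip (n + 1) ρ) : Lip n (fun w => ρ (Fin.cons 0 w)) := by
  obtain ⟨L, hL, H⟩ := h
  refine ⟨L, hL, fun w hw w' hw' => (H _ (cons_mem hw) _ (cons_mem hw')).trans ?_⟩
  refine mul_le_mul_of_nonneg_left ?_ hL
  rw [pi_norm_le_iff_of_nonneg (norm_nonneg _)]
  intro k
  refine Fin.cases ?_ (fun k => ?_) k
  · simp
  · simpa using norm_le_pi_norm (w - w') k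

/-- The class of functions. -/
def Cls (n : ℕ) : Submodule ℝ (Pt n → ℝ) :=
  Submodule.span ℝ {F | ∃ (ρ : (Fin n → ℝ × ℝ) → ℝ) (k : Fin n → ℕ) (m : Fin n → ℤ), Lip n ρ ∧
    ∀ p : Pt n, (∀ l, 0 < p.2 l) →
      F p = ρ (uv n p) * (∏ l, p.1 l ^ k l) * ∏ l, p.2 l ^ m l}

lemma Cls.mulmon {n : ℕ} {F : Pt n → ℝ} (hF : F ∈ Cls n) (k : Fin n → ℕ) (m : Fin n → ℤ) :
    (fun p : Pt n => F p * ((∏ l, p.1 l ^ k l) * ∏ l, p.2 l ^ m l)) ∈ Cls n := by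
  induction hF using Submodule.span_induction with
  | mem F hF =>
    obtain ⟨ρ, k', m', hρ, h⟩ := hF
    refine Submodule.subset_span ⟨ρ, k' + k, m' + m, hρ, fun p hp => ?_⟩
    have e : ∏ l, p.2 l ^ (m' + m) l = (∏ l, p.2 l ^ m' l) * ∏ l, p.2 l ^ m l := by
      rw [← Finset.prod_mul_distrib]
      exact Finset.prod_congr rfl fun l _ => zpow_add₀ (hp l).ne' _ _
    have e' : ∏ l, p.1 l ^ (k' + k) l = (∏ l, p.1 l ^ k' l) * ∏ l, p.1 l ^ k l := by
      rw [← Finset.prod_mul_distrib]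
      exact Finset.prod_congr rfl fun l _ => pow_add _ _ _
    simp only [h p hp, e, e']
    ring
  | zero =>
    convert (Cls n).zero_mem using 1
    funext p; simp
  | add F G _ _ h1 h2 =>
    convert (Cls n).add_mem h1 h2 using 1
    funext p; simp; ring
  | smul c F _ h =>
    convert (Cls n).smul_mem c h using 1
    funext p; simp; ring

lemma Cls.mulaff {n : ℕ} {F : Pt (n + 1) → ℝ} (hF : F ∈ Cls (n + 1)) (r b : ℝ) (i : ℕ) :
    (fun p : Pt (n + 1) => F p * (r * p.1 0 + b) ^ i) ∈ Cls (n + 1) := by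
  induction i with
  | zero => simpa using hF
  | succ i ih =>
    have h1 := Cls.mulmon ih (Fin.cons 1 0) 0
    convert (Cls (n + 1)).add_mem ((Cls (n + 1)).smul_mem r h1) ((Cls (n + 1)).smul_mem b ih) using 1
    funext p
    simp [Fin.prod_univ_succ]; ring

lemma Cls.muly {n : ℕ} {F : Pt (n + 1) → ℝ} (hF : F ∈ Cls (n + 1)) (r : ℝ) (j : ℤ) :
    (fun p : Pt (n + 1) => F p * (r * p.2 0) ^ j) ∈ Cls (n + 1) := by
  have h1 := Cls.mulmon hF 0 (Fin.cons j 0)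
  convert (Cls (n + 1)).smul_mem (r ^ j) h1 using 1
  funext p
  simp [Fin.prod_univ_succ, mul_zpow]; ring

/-- Sector with general `x`-sets. -/
def Sec (n : ℕ) (I : Fin n → Set ℝ) : Set (Pt n) :=
  {p | (∀ k, p.1 k ∈ I k) ∧
       (∀ k l : Fin n, k ≤ l → p.2 l ≤ p.2 k) ∧ (∀ k, 1 < p.2 k)}

/-- forget the first pair -/
def tl {n : ℕ} (p : Pt (n + 1)) : Pt n := (Fin.tail p.1, Fin.tail p.2)
/-- add a first pair -/
def cn {n : ℕ} (x y : ℝ) (q : Pt n) : Pt (n + 1) := (Fin.cons x q.1, Fin.cons y q.2)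

@[simp] lemma tl_cn {n : ℕ} (x y : ℝ) (q : Pt n) : tl (cn x y q) = q := by simp [tl, cn]

lemma tl_mem {n : ℕ} {I : Fin (n + 1) → Set ℝ} {p : Pt (n + 1)} (hp : p ∈ Sec (n + 1) I) :
    tl p ∈ Sec n (Fin.tail I) :=
  ⟨fun k => hp.1 k.succ, fun k l h => hp.2.1 _ _ (Fin.succ_le_succ_iff.2 h), fun k => hp.2.2 _⟩

lemma cn_mem {n : ℕ} {I : Fin (n + 2) → Set ℝ} {x y : ℝ} {q : Pt (n + 1)}
    (hq : q ∈ Sec (n + 1) (Fin.tail I)) (hx : x ∈ I 0) (hy : q.2 0 ≤ y) :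
    cn x y q ∈ Sec (n + 2) I := by
  refine ⟨fun k => ?_, fun k l => ?_, fun k => ?_⟩
  · refine Fin.cases ?_ (fun k => ?_) k
    · simpa [cn] using hx
    · simpa [cn, Fin.tail] using hq.1 k
  · refine Fin.cases ?_ (fun k => ?_) k <;> refine Fin.cases ?_ (fun l => ?_) l
    · simp
    · intro _
      simpa [cn] using (hq.2.1 0 l (Fin.zero_le _)).trans hy
    · intro h
      simp at h
    · intro h
      simpa [cn] using hq.2.1 k l (Fin.succ_le_succ_iff.1 h)
  · refine Fin.cases ?_ (fun k => ?_) k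
    · simpa [cn] using (hq.2.2 0).trans_le hy
    · simpa [cn] using hq.2.2 k

lemma uv_diff {n : ℕ} {p : Pt (n + 1)} :
    ‖uv (n + 1) p - Fin.cons 0 (uv n (tl p))‖ ≤ Real.exp (-(2 * Real.pi * p.2 0)) := by
  rw [pi_norm_le_iff_of_nonneg (Real.exp_pos _).le]
  intro k
  refine Fin.cases ?_ (fun k => ?_) k
  · simp only [uv, Pi.sub_apply, Fin.cons_zero, sub_zero, Prod.norm_def, Real.norm_eq_abs, abs_mul,
      Real.abs_exp]
    refine max_le ?_ ?_
    · exact mul_le_of_le_one_right (Real.exp_pos _).le (Real.abs_cos_le_one _)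
    · exact mul_le_of_le_one_right (Real.exp_pos _).le (Real.abs_sin_le_one _)
  · simp [uv, tl, Fin.tail, Real.exp_nonneg]

lemma exp_bound (S : ℕ) {y : ℝ} (hy : 1 < y) :
    Real.exp (-(2 * Real.pi * y)) * y ^ S ≤ S.factorial := by
  have h1 := Real.pow_div_factorial_le_exp (x := y) (by linarith) S
  have h2 : Real.exp (-(2 * Real.pi * y)) ≤ Real.exp (-y) := by
    apply Real.exp_le_exp.2
    nlinarith [Real.pi_gt_three]
  rw [div_le_iff₀ (by positivity)] at h1
  calc _ ≤ Real.exp (-y) * (Real.exp y * S.factorial) := by gcongr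
    _ = S.factorial := by rw [← mul_assoc, ← Real.exp_add]; simp

/-- the leading sum -/
def lead {n : ℕ} (A : (ℕ × ℤ) →₀ Cls n) (p : Pt (n + 1)) : ℝ :=
  A.sum fun ij a => a.1 (tl p) * (p.1 0 ^ ij.1 * p.2 0 ^ ij.2)

lemma decomp {n : ℕ} {I : Fin (n + 1) → Set ℝ} {R : ℝ} (hR : ∀ k, ∀ x ∈ I k, |x| ≤ R)
    {F : Pt (n + 1) → ℝ} (hF : F ∈ Cls (n + 1)) :
    ∃ A : (ℕ × ℤ) →₀ Cls n, ∃ M : ℝ, ∀ p ∈ Sec (n + 1) I, |F p - lead A p| ≤ M := by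
  induction hF using Submodule.span_induction with
  | mem F hF =>
    obtain ⟨ρ, k, m, hρ, h⟩ := hF
    let a : Pt n → ℝ := fun q => ρ (Fin.cons 0 (uv n q)) * (∏ l, q.1 l ^ k l.succ) *
      ∏ l, q.2 l ^ m l.succ
    have ha : a ∈ Cls n := Submodule.subset_span ⟨_, _, _, hρ.cons, fun q _ => rfl⟩
    obtain ⟨L, hL, H⟩ := hρ
    refine ⟨Finsupp.single (k 0, m 0) ⟨a, ha⟩,
      L * (∏ l, R ^ k l) * ((∑ l, (m l).natAbs).factorial : ℝ), fun p hp => ?_⟩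
    have hpos : ∀ l, 0 < p.2 l := fun l => zero_lt_one.trans (hp.2.2 l)
    have hpos' : ∀ l, 0 < (tl p).2 l := fun l => hpos l.succ
    have e : F p - lead (Finsupp.single (k 0, m 0) ⟨a, ha⟩) p =
        (ρ (uv (n + 1) p) - ρ (Fin.cons 0 (uv n (tl p)))) *
          (∏ l, p.1 l ^ k l) * ∏ l, p.2 l ^ m l := by
      rw [h p hpos, lead, Finsupp.sum_single_index (by simp)]
      simp only [a, Fin.prod_univ_succ, tl, Fin.tail]
      ring
    rw [e, abs_mul, abs_mul]
    have h1 : |ρ (uv (n + 1) p) - ρ (Fin.cons 0 (uv n (tl p)))| ≤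
        L * Real.exp (-(2 * Real.pi * p.2 0)) :=
      (H _ (uv_mem hpos) _ (cons_mem (uv_mem hpos'))).trans
        (mul_le_mul_of_nonneg_left uv_diff hL)
    have h2 : |∏ l, p.1 l ^ k l| ≤ ∏ l, R ^ k l := by
      rw [Finset.abs_prod]
      refine Finset.prod_le_prod (fun _ _ => abs_nonneg _) fun l _ => ?_
      rw [abs_pow]
      exact pow_le_pow_left₀ (abs_nonneg _) (hR l _ (hp.1 l)) _
    have h3 : |∏ l, p.2 l ^ m l| ≤ p.2 0 ^ (∑ l, (m l).natAbs) := by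
      rw [Finset.abs_prod, ← Finset.prod_pow_eq_pow_sum]
      refine Finset.prod_le_prod (fun _ _ => abs_nonneg _) fun l _ => ?_
      rw [abs_of_pos (zpow_pos (hpos l) _)]
      calc p.2 l ^ m l ≤ p.2 l ^ ((m l).natAbs : ℤ) :=
            zpow_le_zpow_right₀ (hp.2.2 l).le (by omega)
        _ = p.2 l ^ (m l).natAbs := zpow_natCast _ _
        _ ≤ _ := pow_le_pow_left₀ (hpos l).le (hp.2.1 _ _ (Fin.zero_le _)) _
    have h4 := exp_bound (∑ l, (m l).natAbs) (hp.2.2 0)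
    have h5 : 0 ≤ ∏ l, R ^ k l := (abs_nonneg _).trans h2
    calc _ ≤ (L * Real.exp (-(2 * Real.pi * p.2 0))) * (∏ l, R ^ k l) *
          p.2 0 ^ (∑ l, (m l).natAbs) := by gcongr
      _ = L * (∏ l, R ^ k l) * (Real.exp (-(2 * Real.pi * p.2 0)) *
          p.2 0 ^ (∑ l, (m l).natAbs)) := by ring
      _ ≤ _ := by gcongr
  | zero => exact ⟨0, 0, fun p _ => by simp [lead]⟩
  | add F G _ _ h1 h2 =>
    obtain ⟨A, M, hA⟩ := h1
    obtain ⟨B, M', hB⟩ := h2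
    refine ⟨A + B, M + M', fun p hp => ?_⟩
    have : lead (A + B) p = lead A p + lead B p := by
      unfold lead
      rw [Finsupp.sum_add_index' (by simp)]
      intro ij a b
      simp; ring
    rw [this, Pi.add_apply]
    calc _ = |(F p - lead A p) + (G p - lead B p)| := by ring_nf
      _ ≤ _ := (abs_add_le _ _).trans (add_le_add (hA p hp) (hB p hp))
  | smul c F _ h =>
    obtain ⟨A, M, hA⟩ := h
    refine ⟨c • A, |c| * M, fun p hp => ?_⟩
    have : lead (c • A) p = c * lead A p := by
      unfold lead
      rw [Finsupp.sum_smul_index' (by simp)]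
      simp [mul_assoc, Finsupp.sum, Finset.mul_sum]
    rw [this, Pi.smul_apply, smul_eq_mul, ← mul_sub, abs_mul]
    exact mul_le_mul_of_nonneg_left (hA p hp) (abs_nonneg _)

lemma vand (N : ℕ) (δ R : ℝ) (hδ : 0 < δ) : ∃ C : ℝ, 0 ≤ C ∧ ∀ X : Fin N → ℝ, (∀ s, |X s| ≤ R) →
    (∀ s t, s ≠ t → δ ≤ |X s - X t|) → ∀ (c : Fin N → ℝ) (M : ℝ),
    (∀ s, |∑ i, c i * X s ^ (i : ℕ)| ≤ M) → ∀ i, |c i| ≤ C * M := by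
  let K : Set (Fin N → ℝ) := {X | (∀ s, |X s| ≤ R) ∧ ∀ s t, s ≠ t → δ ≤ |X s - X t|}
  have hK : IsCompact K := by
    apply Metric.isCompact_of_isClosed_isBounded
    · have : K = (⋂ s, {X | |X s| ≤ R}) ∩ ⋂ s, ⋂ t, ⋂ (_ : s ≠ t), {X | δ ≤ |X s - X t|} := by
        ext X; simp [K]
      rw [this]
      refine IsClosed.inter (isClosed_iInter fun s => isClosed_le (by fun_prop) continuous_const) ?_
      exact isClosed_iInter fun s => isClosed_iInter fun t => isClosed_iInter fun _ =>
        isClosed_le continuous_const (by fun_prop)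
    · rw [isBounded_iff_forall_norm_le]
      refine ⟨max R 0, fun X hX => ?_⟩
      rw [pi_norm_le_iff_of_nonneg (le_max_right _ _)]
      exact fun s => (hX.1 s).trans (le_max_left _ _)
  have hdet : ∀ X ∈ K, (Matrix.vandermonde X).det ≠ 0 := by
    intro X hX
    rw [Matrix.det_vandermonde_ne_zero_iff]
    intro s t hst
    by_contra hne
    have := hX.2 s t hne
    rw [hst, sub_self, abs_zero] at this
    linarith
  have hV : Continuous fun X : Fin N → ℝ => Matrix.vandermonde X := by
    refine continuous_matrix fun i j => ?_
    simp only [Matrix.vandermonde_apply]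
    fun_prop
  let g : (Fin N → ℝ) → ℝ := fun X =>
    (∑ i, ∑ s, |(Matrix.vandermonde X).adjugate i s|) / |(Matrix.vandermonde X).det|
  have hg : ContinuousOn g K := by
    refine ContinuousOn.div ?_ ?_ fun X hX => abs_ne_zero.2 (hdet X hX)
    · refine Continuous.continuousOn ?_
      refine continuous_finsetSum _ fun i _ => continuous_finsetSum _ fun s _ => ?_
      exact (hV.matrix_adjugate.matrix_elem i s).abs
    · exact hV.matrix_det.abs.continuousOn
  obtain ⟨C, hC⟩ := hK.exists_bound_of_continuousOn hg
  refine ⟨max C 0, le_max_right _ _, fun X h1 h2 c M hM i => ?_⟩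
  have hX : X ∈ K := ⟨h1, h2⟩
  have hM0 : 0 ≤ M := (abs_nonneg _).trans (hM i)
  set V := Matrix.vandermonde X with hVdef
  have e1 : V.adjugate.mulVec (V.mulVec c) = V.det • c := by
    rw [Matrix.mulVec_mulVec, Matrix.adjugate_mul, Matrix.smul_mulVec, Matrix.one_mulVec]
  have e2 : V.det * c i = ∑ s, V.adjugate i s * ∑ i, c i * X s ^ (i : ℕ) := by
    have := congrFun e1 i
    simp only [Pi.smul_apply, smul_eq_mul] at this
    rw [← this]
    simp [Matrix.mulVec, dotProduct, hVdef, Matrix.vandermonde_apply, mul_comm]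
  have hd : 0 < |V.det| := abs_pos.2 (hdet X hX)
  have e3 : |V.det| * |c i| ≤ (∑ i, ∑ s, |V.adjugate i s|) * M := by
    rw [← abs_mul, e2]
    calc _ ≤ ∑ s, |V.adjugate i s * ∑ i, c i * X s ^ (i : ℕ)| := Finset.abs_sum_le_sum_abs _ _
      _ ≤ ∑ s, |V.adjugate i s| * M := by
        refine Finset.sum_le_sum fun s _ => ?_
        rw [abs_mul]
        exact mul_le_mul_of_nonneg_left (hM s) (abs_nonneg _)
      _ = (∑ s, |V.adjugate i s|) * M := by rw [Finset.sum_mul]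
      _ ≤ _ := by
        refine mul_le_mul_of_nonneg_right ?_ hM0
        exact Finset.single_le_sum (f := fun i => ∑ s, |V.adjugate i s|)
          (fun _ _ => Finset.sum_nonneg fun _ _ => abs_nonneg _) (Finset.mem_univ i)
  have e4 : |c i| ≤ g X * M := by
    rw [div_mul_eq_mul_div, le_div_iff₀ hd, mul_comm]
    exact e3
  refine e4.trans (mul_le_mul_of_nonneg_right ?_ hM0)
  exact (le_abs_self _).trans ((hC X hX).trans (le_max_left _ _))

lemma fib {ι : Type*} (N : ℕ) (T : Finset ι) (g : ι → ℕ) (hg : ∀ t ∈ T, g t < N) (b : ι → ℝ)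
    (x : ℝ) : ∑ t ∈ T, b t * x ^ g t = ∑ i : Fin N, (∑ t ∈ T with g t = i, b t) * x ^ (i : ℕ) := by
  simp_rw [Finset.sum_filter, Finset.sum_mul]
  rw [Finset.sum_comm]
  refine Finset.sum_congr rfl fun t ht => ?_
  rw [Finset.sum_eq_single (⟨g t, hg t ht⟩ : Fin N)]
  · simp
  · intro i _ hi
    rw [if_neg, zero_mul]
    intro h
    exact hi (Fin.ext h.symm)
  · simp

lemma interp (T : Finset (ℕ × ℤ)) : ∃ N : ℕ, ∀ δ : ℝ, 0 < δ → ∀ R : ℝ, ∃ C : ℝ, 0 ≤ C ∧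
    ∀ X : Fin N → Fin N → ℝ, (∀ t s, |X t s| ≤ R) → (∀ t s s', s ≠ s' → δ ≤ |X t s - X t s'|) →
    ∀ (A : ℕ × ℤ → ℝ) (M : ℝ),
    (∀ t s, |∑ ij ∈ T, A ij * (X t s ^ ij.1 * ((t : ℝ) + 1) ^ ij.2)| ≤ M) →
    ∀ ij ∈ T, |A ij| ≤ C * M := by
  let K : ℕ := ∑ ij ∈ T, ij.2.natAbs
  let N : ℕ := (∑ ij ∈ T, ij.1) + 2 * K + 1
  have hK : ∀ ij ∈ T, ij.2.natAbs ≤ K := fun ij h =>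
    Finset.single_le_sum (f := fun ij : ℕ × ℤ => ij.2.natAbs) (fun _ _ => Nat.zero_le _) h
  have hN : ∀ ij ∈ T, ij.1 < N := fun ij h => by
    have := Finset.single_le_sum (f := fun ij : ℕ × ℤ => ij.1) (fun _ _ => Nat.zero_le _) h
    simp only [N]; omega
  have hg : ∀ ij ∈ T, (ij.2 + K).toNat < N := fun ij h => by
    have := hK ij h
    simp only [N]; omega
  refine ⟨N, fun δ hδ R => ?_⟩
  obtain ⟨C1, hC1, H1⟩ := vand N δ R hδ
  obtain ⟨C2, hC2, H2⟩ := vand N 1 N one_pos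
  refine ⟨C2 * ((N : ℝ) ^ K * C1), by positivity, fun X hX hX' A M hM ij hij => ?_⟩
  have hN0 : 0 < N := Nat.succ_pos _
  have hM0 : 0 ≤ M := (abs_nonneg _).trans (hM ⟨0, hN0⟩ ⟨0, hN0⟩)
  -- first step
  have s1 : ∀ t : Fin N, |∑ e ∈ T with e.1 = ij.1, A e * ((t : ℝ) + 1) ^ e.2| ≤ C1 * M := by
    intro t
    refine H1 (X t) (hX t) (hX' t)
      (fun i => ∑ e ∈ T with e.1 = (i : ℕ), A e * ((t : ℝ) + 1) ^ e.2) M (fun s => ?_) ⟨ij.1, hN ij hij⟩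
    rw [← fib N T (fun e => e.1) hN (fun e => A e * ((t : ℝ) + 1) ^ e.2)]
    convert hM t s using 3
    ring
  have s2 := H2 (fun t => (t : ℝ) + 1) (fun t => ?_) (fun s t hst => ?_)
    (fun l => ∑ e ∈ T.filter (fun e => e.1 = ij.1) with (e.2 + (K : ℤ)).toNat = (l : ℕ), A e)
    ((N : ℝ) ^ K * (C1 * M)) (fun t => ?_) ⟨_, hg ij hij⟩
  · have : (T.filter (fun e => e.1 = ij.1)).filter (fun e => (e.2 + (K : ℤ)).toNat = (ij.2 + (K : ℤ)).toNat)
        = {ij} := by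
      ext e
      simp only [Finset.mem_filter, Finset.mem_singleton]
      constructor
      · rintro ⟨⟨h1, h2⟩, h3⟩
        have := hK e h1
        have := hK ij hij
        exact Prod.ext h2 (by omega)
      · rintro rfl
        exact ⟨⟨hij, rfl⟩, rfl⟩
    simp only [this, Finset.sum_singleton] at s2
    linarith
  · rw [abs_of_nonneg (by positivity)]
    exact_mod_cast t.2
  · have : (s : ℤ) - t ≠ 0 := by
      intro h
      exact hst (Fin.ext (by omega))
    have h := Int.one_le_abs this
    have h' : (1 : ℝ) ≤ |((s : ℤ) : ℝ) - ((t : ℤ) : ℝ)| := by exact_mod_cast h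
    simpa using h'
  · rw [← fib N _ (fun e : ℕ × ℤ => (e.2 + K).toNat) (fun e he => hg e (Finset.mem_filter.1 he).1) A]
    have hpos : (0 : ℝ) < (t : ℝ) + 1 := by positivity
    have e : ∑ e ∈ T with e.1 = ij.1, A e * ((t : ℝ) + 1) ^ (e.2 + K).toNat
        = ((t : ℝ) + 1) ^ K * ∑ e ∈ T with e.1 = ij.1, A e * ((t : ℝ) + 1) ^ e.2 := by
      rw [Finset.mul_sum]
      refine Finset.sum_congr rfl fun e he => ?_
      have h1 := hK e (Finset.mem_filter.1 he).1
      have h2 : ((t : ℝ) + 1) ^ (e.2 + K).toNat = ((t : ℝ) + 1) ^ e.2 * ((t : ℝ) + 1) ^ K := by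
        rw [← zpow_natCast, ← zpow_natCast, ← zpow_add₀ hpos.ne']
        congr 1
        omega
      rw [h2]; ring
    rw [e, abs_mul, abs_of_pos (pow_pos hpos _)]
    have : (t : ℝ) + 1 ≤ N := by exact_mod_cast t.2
    exact mul_le_mul (pow_le_pow_left₀ hpos.le this _) (s1 t) (abs_nonneg _) (by positivity)

lemma lead_cn {n : ℕ} (A : (ℕ × ℤ) →₀ Cls n) (x y : ℝ) (q : Pt n) :
    lead A (cn x y q) = ∑ ij ∈ A.support, (A ij).1 q * (x ^ ij.1 * y ^ ij.2) := by
  simp [lead, Finsupp.sum, cn, tl]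

lemma cls_G {n : ℕ} (A : (ℕ × ℤ) →₀ Cls (n + 1)) (r b : ℝ) :
    (fun q => lead A (cn (r * q.1 0 + b) (r * q.2 0) q)) ∈ Cls (n + 1) := by
  simp only [lead_cn]
  have : (fun q : Pt (n + 1) => ∑ ij ∈ A.support, (A ij).1 q *
      ((r * q.1 0 + b) ^ ij.1 * (r * q.2 0) ^ ij.2)) =
      ∑ ij ∈ A.support, fun q : Pt (n + 1) => (A ij).1 q *
      ((r * q.1 0 + b) ^ ij.1 * (r * q.2 0) ^ ij.2) := by
    funext q; simp
  rw [this]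
  refine Submodule.sum_mem _ fun ij _ => ?_
  have := Cls.muly (Cls.mulaff (A ij).2 r b ij.1) r ij.2
  convert this using 1
  funext q; ring

/-- bounded on test sets -/
def TestBdd (n : ℕ) (I : Fin n → Set ℝ) (F : Pt n → ℝ) : Prop :=
  ∀ n₀ : ℕ, 1 ≤ n₀ → n₀ ≤ n → ∀ (α : Fin n → ℚ) (β : Fin n → ℝ) (ζ : Fin n → ℂ),
    (∀ k, 0 < α k) → (∀ k, 0 < (ζ k).im) →
    ∃ M : ℝ, ∀ p ∈ Sec n I ∩ LinearTestSet n n₀ α β ζ, |F p| ≤ M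

lemma vanish {n : ℕ} {I : Fin (n + 2) → Set ℝ} {F : Pt (n + 2) → ℝ} (hF : TestBdd (n + 2) I F)
    {A : (ℕ × ℤ) →₀ Cls (n + 1)} {M0 : ℝ} (hA : ∀ p ∈ Sec (n + 2) I, |F p - lead A p| ≤ M0)
    {N : ℕ} {C : ℝ} (ξ : Fin N → ℝ) (hξ : ∀ s, ξ s ∈ I 0)
    (H : ∀ (B : ℕ × ℤ → ℝ) (M : ℝ),
      (∀ t s : Fin N, |∑ ij ∈ A.support, B ij * (ξ s ^ ij.1 * ((t : ℝ) + 1) ^ ij.2)| ≤ M) →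
      ∀ ij ∈ A.support, |B ij| ≤ C * M)
    {q : Pt (n + 1)} (hq : q ∈ Sec (n + 1) (Fin.tail I)) :
    ∀ ij ∈ A.support, 0 < ij.2 → (A ij).1 q = 0 := by
  intro ij hij hj
  have hq0 := hq.2.2 0
  obtain ⟨M, hM⟩ := hF 1 le_rfl (by omega) (fun _ => 1) (fun _ => 0)
    (Fin.cons Complex.I fun k => (q.1 k : ℂ) + (q.2 k : ℂ) * Complex.I) (by simp)
    (by
      intro k
      refine Fin.cases ?_ (fun k => ?_) k
      · simp
      · simpa using zero_lt_one.trans (hq.2.2 k))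
  have key : ∀ y : ℝ, q.2 0 ≤ y → |(A ij).1 q| * y ≤ C * (M + M0) := by
    intro y hy
    have hy1 : 1 < y := hq0.trans_le hy
    have h1 := H (fun e => (A e).1 q * y ^ e.2) (M + M0) (fun t s => ?_) ij hij
    · rw [abs_mul, abs_of_pos (zpow_pos (zero_lt_one.trans hy1) _)] at h1
      refine le_trans (mul_le_mul_of_nonneg_left ?_ (abs_nonneg _)) h1
      calc y = y ^ (1 : ℤ) := (zpow_one y).symm
        _ ≤ _ := zpow_le_zpow_right₀ hy1.le (by omega)
    · have ht : (0 : ℝ) ≤ t := by positivity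
      have hmem : cn (ξ s) (y * ((t : ℝ) + 1)) q ∈ Sec (n + 2) I :=
        cn_mem hq (hξ s) (by nlinarith)
      have htest : cn (ξ s) (y * ((t : ℝ) + 1)) q ∈ LinearTestSet (n + 2) 1 (fun _ => 1) (fun _ => 0)
          (Fin.cons Complex.I fun k => (q.1 k : ℂ) + (q.2 k : ℂ) * Complex.I) := by
        refine ⟨fun k l hk hl => ?_, fun k => ?_⟩
        · obtain rfl : k = l := Fin.ext (by omega)
          rfl
        · refine Fin.cases ?_ (fun k => ?_) k
          · simp
          · simp [cn]
      have h2 := hM _ ⟨hmem, htest⟩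
      have h3 := hA _ hmem
      have e : ∑ e ∈ A.support, (A e).1 q * y ^ e.2 * (ξ s ^ e.1 * ((t : ℝ) + 1) ^ e.2)
          = lead A (cn (ξ s) (y * ((t : ℝ) + 1)) q) := by
        rw [lead_cn]
        refine Finset.sum_congr rfl fun e _ => ?_
        rw [mul_zpow]; ring
      rw [e]
      rw [abs_le] at *
      constructor <;> linarith
  by_contra hne
  have hpos : 0 < |(A ij).1 q| := abs_pos.2 hne
  have h1 := key (q.2 0 + |C * (M + M0)| / |(A ij).1 q|) (by
    have : 0 ≤ |C * (M + M0)| / |(A ij).1 q| := by positivity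
    linarith)
  rw [mul_add, mul_div_cancel₀ _ hpos.ne'] at h1
  have := le_abs_self (C * (M + M0))
  nlinarith

theorem main : ∀ (n : ℕ) (I : Fin (n + 1) → Set ℝ) (R : ℝ), (∀ k, IsOpen (I k)) →
    (∀ k, ∀ x ∈ I k, |x| ≤ R) → ∀ F ∈ Cls (n + 1), TestBdd (n + 1) I F →
    ∃ M : ℝ, ∀ p ∈ Sec (n + 1) I, |F p| ≤ M := by
  intro n
  induction n with
  | zero =>
    intro I R _ _ F _ hF
    obtain ⟨M, hM⟩ := hF 1 le_rfl le_rfl (fun _ => 1) (fun _ => 0) (fun _ => Complex.I) (by simp)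
      (by simp)
    refine ⟨M, fun p hp => hM p ⟨hp, fun k l _ _ => ?_, fun k hk => ?_⟩⟩
    · obtain rfl : k = l := Fin.ext (by omega)
      rfl
    · have := k.2
      omega
  | succ n ih =>
    intro I R hI hR F hFc hF
    rcases (I 0).eq_empty_or_nonempty with h0 | ⟨ξ, hξ⟩
    · refine ⟨0, fun p hp => ?_⟩
      have := hp.1 0
      rw [h0] at this
      exact this.elim
    obtain ⟨A, M0, hA⟩ := decomp hR hFc
    obtain ⟨N, HN⟩ := interp A.support
    obtain ⟨η, hη, hball⟩ := Metric.isOpen_iff.1 (hI 0) ξ hξ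
    set δ : ℝ := η / (2 * (N + 1)) with hδdef
    have hδ : 0 < δ := by positivity
    have hNδ : N * δ < η / 2 := by
      rw [hδdef]
      rw [mul_div_assoc', div_lt_div_iff₀ (by positivity) (by positivity)]
      nlinarith
    obtain ⟨C, hC, H⟩ := HN δ hδ R
    let ξs : Fin N → ℝ := fun s => ξ + s * δ
    have hξsep : ∀ s s' : Fin N, s ≠ s' → δ ≤ |ξs s - ξs s'| := by
      intro s s' hne
      have : (s : ℤ) - s' ≠ 0 := by
        intro h
        exact hne (Fin.ext (by omega))
      have h := Int.one_le_abs this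
      have h' : (1 : ℝ) ≤ |(s : ℝ) - (s' : ℝ)| := by exact_mod_cast h
      have e : ξs s - ξs s' = (s - s') * δ := by simp only [ξs]; ring
      rw [e, abs_mul, abs_of_pos hδ]
      nlinarith
    have hX : ∀ (t s : Fin N) (d : ℝ), |d| < δ → ((t : ℝ) + 1) * d + ξs s ∈ I 0 := by
      intro t s d hd
      apply hball
      rw [Metric.mem_ball, Real.dist_eq]
      have e : ((t : ℝ) + 1) * d + ξs s - ξ = ((t : ℝ) + 1) * d + s * δ := by simp only [ξs]; ring
      rw [e]
      have ht : (t : ℝ) + 1 ≤ N := by exact_mod_cast t.2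
      have hs : (s : ℝ) ≤ N := by exact_mod_cast s.2.le
      have h1 : |((t : ℝ) + 1) * d| ≤ N * δ := by
        rw [abs_mul, abs_of_pos (by positivity)]
        exact mul_le_mul ht hd.le (abs_nonneg _) (by positivity)
      have h2 : |(s : ℝ) * δ| ≤ N * δ := by
        rw [abs_of_nonneg (by positivity)]
        exact mul_le_mul_of_nonneg_right hs hδ.le
      have := abs_add_le (((t : ℝ) + 1) * d) (s * δ)
      linarith
    have hξI : ∀ s, ξs s ∈ I 0 := by
      intro s
      have := hX s s 0 (by simpa using hδ)
      simpa using this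
    have hvan : ∀ q ∈ Sec (n + 1) (Fin.tail I), ∀ ij ∈ A.support, 0 < ij.2 → (A ij).1 q = 0 :=
      fun q hq => vanish hF hA ξs hξI (fun B M hB => H (fun _ => ξs) (fun _ s => hR 0 _ (hξI s))
        (fun _ => hξsep) B M hB) hq
    -- boundedness of the coefficients
    have hcoef : ∃ M : ℝ, ∀ q ∈ Sec (n + 1) (Fin.tail I), q.1 0 ∈ Set.Icc (-R) R →
        ∀ ij ∈ A.support, |(A ij).1 q| * q.2 0 ^ ij.2 ≤ M := by
      refine (isCompact_Icc (a := -R) (b := R)).induction_on (p := fun S => ∃ M : ℝ,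
        ∀ q ∈ Sec (n + 1) (Fin.tail I), q.1 0 ∈ S →
        ∀ ij ∈ A.support, |(A ij).1 q| * q.2 0 ^ ij.2 ≤ M) ⟨0, by simp⟩ ?_ ?_ ?_
      · rintro S S' hS ⟨M, hM⟩
        exact ⟨M, fun q hq h => hM q hq (hS h)⟩
      · rintro S S' ⟨M, hM⟩ ⟨M', hM'⟩
        refine ⟨max M M', fun q hq h ij hij => ?_⟩
        rcases h with h | h
        · exact (hM q hq h ij hij).trans (le_max_left _ _)
        · exact (hM' q hq h ij hij).trans (le_max_right _ _)
      · intro c _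
        refine ⟨Metric.ball c δ, mem_nhdsWithin_of_mem_nhds (Metric.ball_mem_nhds c hδ), ?_⟩
        let J : Fin (n + 1) → Set ℝ := fun k => if k = 0 then I 1 ∩ Metric.ball c δ else I k.succ
        have hJ0 : ∀ q, q ∈ Sec (n + 1) J ↔ q ∈ Sec (n + 1) (Fin.tail I) ∧ q.1 0 ∈ Metric.ball c δ := by
          intro q
          constructor
          · intro h
            have h0 := h.1 0
            simp only [J, if_true] at h0
            refine ⟨⟨fun k => ?_, h.2⟩, h0.2⟩
            by_cases hk : k = 0
            · subst hk; exact h0.1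
            · have := h.1 k
              simp only [J, if_neg hk] at this
              exact this
          · rintro ⟨h, h0⟩
            refine ⟨fun k => ?_, h.2⟩
            by_cases hk : k = 0
            · subst hk; simp only [J, if_true]; exact ⟨h.1 0, h0⟩
            · simp only [J, if_neg hk]; exact h.1 k
        have hG : ∀ t s : Fin N, ∃ M : ℝ, ∀ q ∈ Sec (n + 1) J,
            |lead A (cn (((t : ℝ) + 1) * q.1 0 + (ξs s - ((t : ℝ) + 1) * c))
              (((t : ℝ) + 1) * q.2 0) q)| ≤ M := by
          intro t s
          refine ih J R ?_ ?_ _ (cls_G A _ _) ?_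
          · intro k
            by_cases hk : k = 0
            · simp only [J, if_pos hk]; exact (hI 1).inter Metric.isOpen_ball
            · simp only [J, if_neg hk]; exact hI _
          · intro k x hx
            by_cases hk : k = 0
            · simp only [J, if_pos hk] at hx; exact hR 1 x hx.1
            · simp only [J, if_neg hk] at hx; exact hR _ x hx
          · intro n₀ h1 h2 α β ζ hα hζ
            obtain ⟨M, hM⟩ := hF (n₀ + 1) (by omega) (by omega)
              (Fin.cons (α 0 / ((t : ℕ) + 1)) α)
              (Fin.cons (β 0 - (α 0 / ((t : ℕ) + 1) : ℚ) * (ξs s - ((t : ℝ) + 1) * c)) β)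
              (Fin.cons Complex.I ζ)
              (by
                intro k
                refine Fin.cases ?_ (fun k => ?_) k
                · have := hα 0
                  simp only [Fin.cons_zero]; positivity
                · simpa using hα k)
              (by
                intro k
                refine Fin.cases ?_ (fun k => ?_) k
                · simp
                · simpa using hζ k)
            refine ⟨M + M0, ?_⟩
            rintro q ⟨hqJ, hq1, hq2⟩
            obtain ⟨hq, hqc⟩ := (hJ0 q).1 hqJ
            have hq0 := hq.2.2 0
            have ht : (0 : ℝ) ≤ t := by positivity
            have hmem : cn (((t : ℝ) + 1) * q.1 0 + (ξs s - ((t : ℝ) + 1) * c))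
              (((t : ℝ) + 1) * q.2 0) q ∈ Sec (n + 2) I := by
              refine cn_mem hq ?_ (by nlinarith)
              have := hX t s (q.1 0 - c) (by simpa [Real.dist_eq] using hqc)
              convert this using 1
              ring
            have h0 : ∀ l : Fin (n + 1), (l : ℕ) < n₀ →
                ((α 0 / ((t : ℕ) + 1) : ℚ) : ℂ) *
                  (((((t : ℝ) + 1) * q.1 0 + (ξs s - ((t : ℝ) + 1) * c) : ℝ) : ℂ) +
                   ((((t : ℝ) + 1) * q.2 0 : ℝ) : ℂ) * Complex.I) +
                  ((β 0 - (α 0 / ((t : ℕ) + 1) : ℚ) * (ξs s - ((t : ℝ) + 1) * c) : ℝ) : ℂ) =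
                (α l : ℂ) * ((q.1 l : ℂ) + (q.2 l : ℂ) * Complex.I) + (β l : ℂ) := by
              intro l hl
              rw [← hq1 0 l h1 hl]
              have hne : ((t : ℕ) : ℂ) + 1 ≠ 0 := by exact_mod_cast Nat.succ_ne_zero (t : ℕ)
              push_cast
              field_simp
              ring
            have h3 := hM _ ⟨hmem, fun k l => ?_, fun k => ?_⟩
            · have h4 := hA _ hmem
              rw [abs_le] at *
              constructor <;> linarith
            · refine Fin.cases ?_ (fun k => ?_) k <;> refine Fin.cases ?_ (fun l => ?_) l
              · intros; rfl
              · intro _ hl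
                exact h0 l (by simpa using hl)
              · intro hk _
                exact (h0 k (by simpa using hk)).symm
              · intro hk hl
                exact hq1 k l (by simpa using hk) (by simpa using hl)
            · refine Fin.cases ?_ (fun k => ?_) k
              · simp
              · intro hk
                exact hq2 k (by simpa using hk)
        choose G hG using hG
        refine ⟨C * ∑ t, ∑ s, |G t s|, fun q hq hqc ij hij => ?_⟩
        have hqJ := (hJ0 q).2 ⟨hq, hqc⟩
        have hXm : ∀ t s, ((t : Fin N) + 1 : ℝ) * q.1 0 + (ξs s - ((t : ℝ) + 1) * c) ∈ I 0 := by
          intro t s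
          have := hX t s (q.1 0 - c) (by simpa [Real.dist_eq] using hqc)
          convert this using 1
          ring
        have hq0 := hq.2.2 0
        have h1 := H (fun t s => ((t : ℝ) + 1) * q.1 0 + (ξs s - ((t : ℝ) + 1) * c))
          (fun t s => hR 0 _ (hXm t s))
          (fun t s s' hne => by
            have := hξsep s s' hne
            convert this using 2
            ring)
          (fun e => (A e).1 q * q.2 0 ^ e.2) (∑ t, ∑ s, |G t s|) (fun t s => ?_) ij hij
        · rwa [abs_mul, abs_of_pos (zpow_pos (zero_lt_one.trans hq0) _)] at h1
        · have h2 := hG t s q hqJ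
          rw [lead_cn] at h2
          have e : ∑ e ∈ A.support, (A e).1 q * q.2 0 ^ e.2 *
              ((((t : ℝ) + 1) * q.1 0 + (ξs s - ((t : ℝ) + 1) * c)) ^ e.1 * ((t : ℝ) + 1) ^ e.2) =
              ∑ e ∈ A.support, (A e).1 q *
              ((((t : ℝ) + 1) * q.1 0 + (ξs s - ((t : ℝ) + 1) * c)) ^ e.1 *
                (((t : ℝ) + 1) * q.2 0) ^ e.2) := by
            refine Finset.sum_congr rfl fun e _ => ?_
            rw [mul_zpow]; ring
          rw [e]
          refine h2.trans ((le_abs_self _).trans ?_)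
          calc |G t s| ≤ ∑ s, |G t s| :=
                Finset.single_le_sum (f := fun s => |G t s|) (fun _ _ => abs_nonneg _) (Finset.mem_univ s)
            _ ≤ _ := Finset.single_le_sum (f := fun t => ∑ s, |G t s|)
                (fun _ _ => Finset.sum_nonneg fun _ _ => abs_nonneg _) (Finset.mem_univ t)
    obtain ⟨M, hM⟩ := hcoef
    refine ⟨M0 + ∑ ij ∈ A.support, M * R ^ ij.1, fun p hp => ?_⟩
    have hq := tl_mem hp
    have hp0 := hR 0 _ (hp.1 0)
    have hlead : |lead A p| ≤ ∑ ij ∈ A.support, M * R ^ ij.1 := by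
      unfold lead Finsupp.sum
      refine (Finset.abs_sum_le_sum_abs _ _).trans (Finset.sum_le_sum fun ij hij => ?_)
      beta_reduce
      have h1 := hM (tl p) hq (abs_le.1 (hR 1 _ (hp.1 1))) ij hij
      have hpos : 0 < (tl p).2 0 := zero_lt_one.trans (hq.2.2 0)
      have hy : (tl p).2 0 ≤ p.2 0 := hp.2.1 0 1 (Fin.zero_le _)
      have hM0 : 0 ≤ M := le_trans (by positivity) h1
      have hR0 : 0 ≤ R := (abs_nonneg _).trans hp0
      rcases lt_or_ge 0 ij.2 with hj | hj
      · rw [hvan _ hq ij hij hj]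
        simp only [zero_mul, abs_zero]
        positivity
      · have hz : p.2 0 ^ ij.2 ≤ (tl p).2 0 ^ ij.2 := by
          obtain ⟨j, hj'⟩ := Int.exists_eq_neg_ofNat hj
          rw [hj', zpow_neg, zpow_neg, zpow_natCast, zpow_natCast]
          exact inv_anti₀ (pow_pos hpos _) (pow_le_pow_left₀ hpos.le hy _)
        rw [abs_mul, abs_mul, abs_pow, abs_of_pos (zpow_pos (hpos.trans_le hy) _)]
        calc _ = (|(A ij).1 (tl p)| * p.2 0 ^ ij.2) * |p.1 0| ^ ij.1 := by ring
          _ ≤ (|(A ij).1 (tl p)| * (tl p).2 0 ^ ij.2) * R ^ ij.1 := by gcongr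
          _ ≤ _ := by gcongr
    have h2 := hA p hp
    have : F p = (F p - lead A p) + lead A p := by ring
    rw [this]
    exact (abs_add_le _ _).trans (add_le_add h2 hlead)

/-- Let `n = m + 2 ≥ 2` and let `f` be a polynomially tamed function
on `Σ_n` of the form `f = ∑_{(i,j)} a_{i,j} (x¹)^i (y¹)^j` with `i ≥ 0`, `j ≤ 0`,
where each coefficient `a_{i,j}` does not depend on `(x¹, y¹)` and belongs to the
ring `O'(x,y)` in the remaining variables. If `|f| ≺ 1` on every linear test set,
then `|a_{i,j}|·(y¹)^j ≺ 1` on `Σ_n` for every pair `(i,j)` occurring in the sum. -/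
theorem statement2 (m : ℕ) (f : Pt (m + 2) → ℝ)
    (T : Finset (ℕ × ℤ)) (hT : ∀ ij ∈ T, ij.2 ≤ 0)
    (a : ℕ × ℤ → Pt (m + 2) → ℝ)
    (hindep : ∀ ij ∈ T, ∀ p q : Pt (m + 2),
      (∀ k : Fin (m + 1), p.1 k.succ = q.1 k.succ ∧ p.2 k.succ = q.2 k.succ) →
      a ij p = a ij q)
    (hO' : ∀ ij ∈ T, InOFrac (m + 1)
      (fun q : Pt (m + 1) =>
        a ij (Fin.cons (1 / 2) q.1, Fin.cons (q.2 0 + 1) q.2)))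
    (hsum : ∀ p ∈ GrowthSector (m + 2),
      f p = ∑ ij ∈ T, a ij p * p.1 0 ^ ij.1 * p.2 0 ^ ij.2)
    (hpoly : PolyTamed (m + 2) f)
    (hyp : ∀ n₀ : ℕ, 1 ≤ n₀ → n₀ ≤ m + 2 →
      ∀ (α : Fin (m + 2) → ℚ) (β : Fin (m + 2) → ℝ) (ζ : Fin (m + 2) → ℂ),
        (∀ k, 0 < α k) → (∀ k, 0 < (ζ k).im) →
        Prec (GrowthSector (m + 2) ∩ LinearTestSet (m + 2) n₀ α β ζ)
          (fun p => |f p|) (fun _ => 1)) :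
    ∀ ij ∈ T,
      Prec (GrowthSector (m + 2)) (fun p => |a ij p| * p.2 0 ^ ij.2) (fun _ => 1) := by
  have hsec : GrowthSector (m + 2) = Sec (m + 2) (fun _ => Set.Ioo 0 1) := rfl
  obtain ⟨M, hM⟩ : ∃ M : ℝ, ∀ p ∈ GrowthSector (m + 2), |f p| ≤ M := by
    obtain ⟨g, h, ⟨T', ρ, hρ, hg⟩, ⟨_, μ, C₁, C₂, hCC, hh⟩, hne, hfg⟩ := hpoly
    have hmon : ∀ p ∈ GrowthSector (m + 2), 0 < monomial (m + 2) μ p := fun p hp =>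
      Finset.prod_pos fun k _ => zpow_pos (zero_lt_one.trans (hp.2.2 k)) _
    have hC1 : 0 < |C₁| := abs_pos.2 (left_ne_zero_of_mul hCC.ne')
    have hC2 : 0 < |C₂| := abs_pos.2 (right_ne_zero_of_mul hCC.ne')
    have hhb : ∀ p ∈ GrowthSector (m + 2),
        min |C₁| |C₂| * monomial (m + 2) μ p ≤ |h p| ∧
        |h p| ≤ max |C₁| |C₂| * monomial (m + 2) μ p := by
      intro p hp
      have h0 := hmon p hp
      obtain ⟨h1, h2⟩ := hh p hp
      rcases pos_and_pos_or_neg_and_neg_of_mul_pos hCC with ⟨a1, a2⟩ | ⟨a1, a2⟩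
      · have : 0 < h p := lt_trans (by positivity) h1
        rw [abs_of_pos this, abs_of_pos a1, abs_of_pos a2]
        constructor
        · exact le_trans (mul_le_mul_of_nonneg_right (min_le_left _ _) h0.le) h1.le
        · exact h2.le.trans (mul_le_mul_of_nonneg_right (le_max_right _ _) h0.le)
      · have : h p < 0 := h2.trans (mul_neg_of_neg_of_pos a2 h0)
        rw [abs_of_neg this, abs_of_neg a1, abs_of_neg a2]
        constructor
        · refine le_trans (mul_le_mul_of_nonneg_right (min_le_right _ _) h0.le) ?_
          linarith
        · refine le_trans ?_ (mul_le_mul_of_nonneg_right (le_max_left _ _) h0.le)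
          linarith
    choose! ρ' hρ' hρρ using hρ
    let F : Pt (m + 2) → ℝ := fun p => (∑ km ∈ T', ρ' km (uv (m + 2) p) * (∏ k, p.1 k ^ km.1 k) *
      (∏ k, p.2 k ^ km.2 k)) * ((∏ k, p.1 k ^ (0 : Fin (m + 2) → ℕ) k) * ∏ k, p.2 k ^ (-μ) k)
    have hFc : F ∈ Cls (m + 2) := by
      refine Cls.mulmon (F := fun p => ∑ km ∈ T', ρ' km (uv (m + 2) p) * (∏ k, p.1 k ^ km.1 k) *
        (∏ k, p.2 k ^ km.2 k)) ?_ 0 (-μ)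
      have : (fun p : Pt (m + 2) => ∑ km ∈ T', ρ' km (uv (m + 2) p) * (∏ k, p.1 k ^ km.1 k) *
          (∏ k, p.2 k ^ km.2 k)) = ∑ km ∈ T', fun p : Pt (m + 2) => ρ' km (uv (m + 2) p) *
          (∏ k, p.1 k ^ km.1 k) * (∏ k, p.2 k ^ km.2 k) := by
        funext p; simp
      rw [this]
      exact Submodule.sum_mem _ fun km hkm =>
        Submodule.subset_span ⟨ρ' km, km.1, km.2, (hρ' km hkm).lip, fun p _ => rfl⟩
    have hF : ∀ p ∈ GrowthSector (m + 2), F p = f p * h p / monomial (m + 2) μ p := by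
      intro p hp
      have e1 : g p = ∑ km ∈ T', ρ' km (uv (m + 2) p) * (∏ k, p.1 k ^ km.1 k) *
          (∏ k, p.2 k ^ km.2 k) := by
        rw [hg p hp]
        refine Finset.sum_congr rfl fun km hkm => ?_
        rw [hρρ km hkm p hp]
      have e2 : f p * h p = g p := by rw [hfg p hp, div_mul_cancel₀ _ (hne p hp)]
      simp only [F]
      rw [e2, ← e1, div_eq_mul_inv, monomial, ← Finset.prod_inv_distrib]
      simp
    have hFabs : ∀ p ∈ GrowthSector (m + 2), min |C₁| |C₂| * |f p| ≤ |F p| ∧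
        |F p| ≤ max |C₁| |C₂| * |f p| := by
      intro p hp
      have h0 := hmon p hp
      obtain ⟨h1, h2⟩ := hhb p hp
      rw [hF p hp, abs_div, abs_mul, abs_of_pos h0, le_div_iff₀ h0, div_le_iff₀ h0]
      constructor
      · nlinarith [abs_nonneg (f p)]
      · nlinarith [abs_nonneg (f p)]
    have hmin : 0 < min |C₁| |C₂| := lt_min hC1 hC2
    have hmax : 0 ≤ max |C₁| |C₂| := le_max_of_le_left hC1.le
    obtain ⟨M, hM⟩ := main (m + 1) (fun _ => Set.Ioo 0 1) 1 (fun _ => isOpen_Ioo)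
      (fun k x hx => by
        rw [abs_of_pos hx.1]
        exact hx.2.le) F hFc (by
        intro n₀ h1 h2 α β ζ hα hζ
        obtain ⟨C, hC, H⟩ := hyp n₀ h1 h2 α β ζ hα hζ
        refine ⟨max |C₁| |C₂| * (C * 1), fun p hp => ?_⟩
        exact (hFabs p hp.1).2.trans (mul_le_mul_of_nonneg_left (H p hp).le hmax))
    refine ⟨M / min |C₁| |C₂|, fun p hp => ?_⟩
    rw [le_div_iff₀ hmin, mul_comm]
    exact (hFabs p hp).1.trans (hM p hp)
  obtain ⟨N, HN⟩ := interp T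
  have hN1 : (0 : ℝ) < (N : ℝ) + 1 := by positivity
  obtain ⟨C, hC, H⟩ := HN (1 / ((N : ℝ) + 1)) (by positivity) 1
  intro ij hij
  refine ⟨|C * M| + 1, by positivity, fun p hp => ?_⟩
  have hξ : ∀ s : Fin N, ((s : ℝ) + 1) / ((N : ℝ) + 1) ∈ Set.Ioo (0 : ℝ) 1 := by
    intro s
    refine ⟨by positivity, ?_⟩
    rw [div_lt_one hN1]
    have : (s : ℝ) < N := by exact_mod_cast s.2
    linarith
  have hq : tl p ∈ Sec (m + 1) (Fin.tail (fun _ : Fin (m + 2) => Set.Ioo (0 : ℝ) 1)) :=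
    tl_mem (I := fun _ => Set.Ioo 0 1) hp
  have hq0 : 1 < (tl p).2 0 := hq.2.2 0
  have hpos : 0 < (tl p).2 0 := zero_lt_one.trans hq0
  have hy : (tl p).2 0 ≤ p.2 0 := hp.2.1 0 1 (Fin.zero_le _)
  have h1 := H (fun _ s => ((s : ℝ) + 1) / ((N : ℝ) + 1))
    (fun _ s => by
      rw [abs_of_pos (hξ s).1]
      exact (hξ s).2.le)
    (fun _ s s' hne => by
      have h0 : (s : ℤ) - s' ≠ 0 := by
        intro h
        exact hne (Fin.ext (by omega))
      have h := Int.one_le_abs h0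
      have h' : (1 : ℝ) ≤ |(s : ℝ) - (s' : ℝ)| := by exact_mod_cast h
      have e : ((s : ℝ) + 1) / ((N : ℝ) + 1) - ((s' : ℝ) + 1) / ((N : ℝ) + 1) =
        ((s : ℝ) - s') / ((N : ℝ) + 1) := by ring
      rw [e, abs_div, abs_of_pos hN1]
      gcongr)
    (fun e => a e p * (tl p).2 0 ^ e.2) M (fun t s => ?_) ij hij
  · rw [abs_mul, abs_of_pos (zpow_pos hpos _)] at h1
    have hz : p.2 0 ^ ij.2 ≤ (tl p).2 0 ^ ij.2 := by
      obtain ⟨j, hj'⟩ := Int.exists_eq_neg_ofNat (hT ij hij)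
      rw [hj', zpow_neg, zpow_neg, zpow_natCast, zpow_natCast]
      exact inv_anti₀ (pow_pos hpos _) (pow_le_pow_left₀ hpos.le hy _)
    have h2 := mul_le_mul_of_nonneg_left hz (abs_nonneg (a ij p))
    have h3 := le_abs_self (C * M)
    show |a ij p| * p.2 0 ^ ij.2 < (|C * M| + 1) * 1
    linarith
  · have ht : (0 : ℝ) ≤ t := by positivity
    have hmem : cn (((s : ℝ) + 1) / ((N : ℝ) + 1)) (((t : ℝ) + 1) * (tl p).2 0) (tl p) ∈
        GrowthSector (m + 2) :=
      cn_mem (I := fun _ => Set.Ioo 0 1) hq (hξ s) (by nlinarith)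
    have h2 := hM _ hmem
    rw [hsum _ hmem] at h2
    convert h2 using 2
    refine Finset.sum_congr rfl fun e he => ?_
    rw [hindep e he (cn _ _ (tl p)) p (fun k => by simp [cn, tl, Fin.tail])]
    simp only [cn, Fin.cons_zero, mul_zpow]
    ring

end

end TamePaper
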